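/- arXiv:math/0404333 — 2 statements merged into one kernel-verified Lean document; each statement's English description precedes it below -/
import Mathlib

section
/- Let u be an integer with u ≡ 3 (mod 4) such that p = u² + 64 is prime. Then the group of rational points E₀(ℚ) of the Neumann–Setzer curve E₀ : y² + xy = x³ − ((u+1)/4)x² + 4x − u is isomorphic to ℤ/2ℤ. -/
/-- The Neumann–Setzer curve `E₀ : y² + xy = x³ − ((u+1)/4)x² + 4x − u` over `ℚ`,
in affine coordinates. -/
noncomputable def NeumannSetzerE₀ (u : ℤ) : WeierstrassCurve.Affine ℚ :=
  { a₁ := 1, a₂ := -(((u : ℚ) + 1) / 4), a₃ := 0, a₄ := 4, a₆ := -(u : ℚ) }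

/-- If a square is a product of two coprime integers, a positive factor is a square. -/
theorem exists_sq_of_coprime_mul {a b c : ℤ} (ha : 0 < a) (hab : IsCoprime a b)
    (h : a * b = c ^ 2) : ∃ r, 0 ≤ r ∧ a = r ^ 2 := by
  obtain ⟨r, hr | hr⟩ := Int.sq_of_isCoprime hab h
  · exact ⟨|r|, abs_nonneg _, by rw [sq_abs, hr]⟩
  · nlinarith [sq_nonneg r]

/-- If a fourth power is a product of two coprime positive integers, both are fourth powers. -/
theorem exists_fourth_powers_of_coprime_mul {a b c : ℤ} (ha : 0 < a) (hb : 0 < b)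
    (hab : IsCoprime a b) (h : a * b = c ^ 4) :
    ∃ r s : ℤ, a = r ^ 4 ∧ b = s ^ 4 ∧ c = r * s ∧ IsCoprime r s := by
  have fourth : ∀ {a b c : ℤ}, 0 < a → 0 < b → IsCoprime a b → a * b = c ^ 4 →
      ∃ r, a = r ^ 4 := by
    intro a b c ha hb hab h
    obtain ⟨a', ha', rfl⟩ := exists_sq_of_coprime_mul ha hab (c := c ^ 2) (by rw [h]; ring)
    obtain ⟨b', hb', rfl⟩ := exists_sq_of_coprime_mul hb hab.symm (c := c ^ 2) (by rw [mul_comm, h]; ring)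
    have hc : a' * b' = c ^ 2 := by
      have : (a' * b') ^ 2 = (c ^ 2) ^ 2 := by rw [mul_pow, h]; ring
      exact (pow_left_inj₀ (by positivity) (by positivity) two_ne_zero).mp this
    have hcop : IsCoprime a' b' := (IsCoprime.pow_iff two_pos two_pos).mp hab
    obtain ⟨r, -, rfl⟩ :=
      exists_sq_of_coprime_mul (lt_of_le_of_ne ha' (by rintro rfl; simp at ha)) hcop hc
    exact ⟨r, by ring⟩
  obtain ⟨r, rfl⟩ := fourth ha hb hab h
  obtain ⟨s, rfl⟩ := fourth hb ha hab.symm (by rw [mul_comm, h])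
  have hcop : IsCoprime r s := (IsCoprime.pow_iff four_pos four_pos).mp hab
  have hc : |c| = |r * s| := by
    refine (pow_left_inj₀ (abs_nonneg _) (abs_nonneg _) four_ne_zero).mp ?_
    rw [← abs_pow, ← abs_pow, ← h]; ring_nf
  rcases abs_eq_abs.mp hc with hc | hc
  · exact ⟨r, s, rfl, rfl, hc, hcop⟩
  · exact ⟨-r, s, by ring, rfl, by rw [hc]; ring, hcop.neg_left⟩

/-- If `p` times a fourth power is a product of two coprime positive integers, one of them is a
fourth power and the other is `p` times a fourth power. -/
theorem exists_add_eq_of_coprime_mul_eq_prime_mul {p A B ρ : ℤ} (hp : Prime p) (hp0 : 0 < p)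
    (hA : 0 < A) (hB : 0 < B) (hAB : IsCoprime A B) (h : A * B = p * ρ ^ 4) :
    ∃ m n : ℤ, ρ = m * n ∧ IsCoprime m n ∧ A + B = m ^ 4 + p * n ^ 4 := by
  wlog hpB : p ∣ B generalizing A B
  · have hpA : p ∣ A := ((hp.dvd_or_dvd ⟨_, h⟩).resolve_right hpB)
    rw [add_comm]
    exact this hB hA hAB.symm (by rw [mul_comm, h]) hpA
  obtain ⟨B, rfl⟩ := hpB
  have h' : A * B = ρ ^ 4 := mul_left_cancel₀ hp.ne_zero (by rw [← h]; ring)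
  obtain ⟨m, n, rfl, rfl, hρ, hmn⟩ := exists_fourth_powers_of_coprime_mul hA
    (pos_of_mul_pos_right hB hp0.le) hAB.of_mul_right_right h'
  exact ⟨m, n, hρ, hmn, rfl⟩

/-- Two factors of `p ρ⁴` whose difference is coprime to `ρ`, up to a factor coprime to one of
them, are coprime. -/
theorem isCoprime_of_mul_eq_prime_mul {p A B ρ M D : ℤ} (hp : Prime p) (hρ : ρ ≠ 0)
    (h : A * B = p * ρ ^ 4)
    (hD : IsCoprime D A) (hM : IsCoprime M ρ) (hBA : B - A = D * M) : IsCoprime A B := by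
  have hA0 : A ≠ 0 := by
    rintro rfl
    simp [hp.ne_zero, hρ] at h
  refine isCoprime_of_prime_dvd (fun h0 => hA0 h0.1) fun q hq hqA hqB => ?_
  have hqM : q ∣ M := by
    have : q ∣ D * M := hBA ▸ dvd_sub hqB hqA
    refine (hq.dvd_or_dvd this).resolve_left fun hqD => hq.not_isUnit ?_
    exact hD.isUnit_of_dvd' hqD hqA
  have hqρ : IsCoprime (q * q) (ρ ^ 4) :=
    have := (hM.of_isCoprime_of_dvd_left hqM).pow_right (n := 4)
    this.mul_left this
  have hqq : q * q ∣ p := hqρ.dvd_of_dvd_mul_right (h ▸ mul_dvd_mul hqA hqB)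
  exact hq.not_isUnit (hp.irreducible.squarefree q hqq)

/-- The second half of the descent: a point with square image on the isogenous curve lifts. -/
theorem exists_of_factorization {u A B ρ M D σ : ℤ} (hp : Prime (u ^ 2 + 64)) (hρ : ρ ≠ 0)
    (h : A * B = (u ^ 2 + 64) * ρ ^ 4) (hD : IsCoprime D A) (hM : IsCoprime M ρ)
    (hBA : B - A = D * M) (hσ : A + B = σ ^ 2 - 2 * u * ρ ^ 2) :
    ∃ m n : ℤ, ρ = m * n ∧ IsCoprime m n ∧
      σ ^ 2 = (m ^ 2 + u * n ^ 2) ^ 2 + 64 * n ^ 4 := by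
  have hAB := isCoprime_of_mul_eq_prime_mul hp hρ h hD hM hBA
  have hp0 : 0 < u ^ 2 + 64 := by positivity
  have hpos : 0 < A * B := by rw [h]; positivity
  rcases pos_and_pos_or_neg_and_neg_of_mul_pos hpos with ⟨hA, hB⟩ | ⟨hA, hB⟩
  · obtain ⟨m, n, rfl, hmn, hs⟩ := exists_add_eq_of_coprime_mul_eq_prime_mul hp hp0 hA hB hAB h
    exact ⟨m, n, rfl, hmn, by linear_combination hs - hσ⟩
  · obtain ⟨m, n, rfl, hmn, hs⟩ := exists_add_eq_of_coprime_mul_eq_prime_mul hp hp0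
      (neg_pos.mpr hA) (neg_pos.mpr hB) hAB.neg_neg (by rw [neg_mul_neg, h])
    have hn : n ≠ 0 := right_ne_zero_of_mul hρ
    have hn4 : 0 < n ^ 4 := by positivity
    nlinarith [sq_nonneg (m ^ 2 - u * n ^ 2), sq_nonneg σ]

/-- The first half of the descent: the factors of a fourth power with given difference. -/
theorem exists_fourth_powers_of_sub {a b c w : ℤ} (ha : 0 < a) (hb : 0 < b) (h : a * b = c ^ 4)
    (hw : b - a = w) (hwc : IsCoprime w c) :
    ∃ r s : ℤ, w = s ^ 4 - r ^ 4 ∧ c = r * s ∧ IsCoprime r s := by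
  have hab : IsCoprime a b := by
    refine isCoprime_of_prime_dvd (fun h0 => ha.ne' h0.1) fun q hq hqa hqb => hq.not_isUnit ?_
    exact hwc.isUnit_of_dvd' (hw ▸ dvd_sub hqb hqa)
      (hq.dvd_of_dvd_pow (h ▸ hqa.mul_right b))
  obtain ⟨r, s, rfl, rfl, hc, hrs⟩ := exists_fourth_powers_of_coprime_mul ha hb hab h
  exact ⟨r, s, hw.symm, hc, hrs⟩

theorem sq_emod_four_of_odd {x : ℤ} (hx : Odd x) : x ^ 2 % 4 = 1 := by
  rw [sq]; rcases hx with ⟨k, rfl⟩; ring_nf; omega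

theorem sq_emod_four_of_even {x : ℤ} (hx : Even x) : x ^ 2 % 4 = 0 := by
  rw [sq]; rcases hx with ⟨k, rfl⟩; ring_nf; omega

/-- Infinite descent on the quartic `N² = (M² + u e²)² + 64 e⁴`. -/
theorem no_solution_quartic {u : ℤ} (hu : u % 4 = 3) (hp : Prime (u ^ 2 + 64)) (k : ℕ) :
    ∀ M e N : ℤ, e.natAbs = k → e ≠ 0 → M ≠ 0 → IsCoprime M e →
      N ^ 2 = (M ^ 2 + u * e ^ 2) ^ 2 + 64 * e ^ 4 → False := by
  induction k using Nat.strong_induction_on with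
  | _ k ih =>
  intro M e N hk he hM hMe hN
  wlog hN0 : 0 ≤ N generalizing N
  · exact this (-N) (by rw [neg_sq, hN]) (by linarith)
  subst hk
  set w := M ^ 2 + u * e ^ 2 with hw
  have huodd : Odd u := by rw [Int.odd_iff]; omega
  have he4 : 0 < e ^ 4 := by positivity
  have hlt : |w| < N := abs_lt_of_sq_lt_sq (by linarith) hN0
  obtain ⟨hlt1, hlt2⟩ := abs_lt.mp hlt
  have hwe : IsCoprime w e := by
    have := (hMe.pow_left (m := 2)).add_mul_left_left (u * e)
    rwa [show M ^ 2 + e * (u * e) = w by rw [hw]; ring] at this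
  have descend : ∀ m n c N' : ℤ, e = c * (m * n) → IsCoprime m n →
      N' ^ 2 = (m ^ 2 + u * n ^ 2) ^ 2 + 64 * n ^ 4 → c.natAbs = 1 ∧ m.natAbs = 1 := by
    intro m n c N' hemn hmn hN'
    have hc : c ≠ 0 := by rintro rfl; simp_all
    have hm : m ≠ 0 := by rintro rfl; simp_all
    have hn : n ≠ 0 := by rintro rfl; simp_all
    have hle : ¬ n.natAbs < e.natAbs := fun hlt => ih _ hlt m n N' rfl hn hm hmn hN'
    have hn' : 0 < n.natAbs := Int.natAbs_pos.mpr hn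
    rw [hemn, Int.natAbs_mul, Int.natAbs_mul, ← mul_assoc, not_lt] at hle
    have h1 : c.natAbs * m.natAbs ≤ 1 := by
      by_contra! h2
      nlinarith
    have h2 : c.natAbs * m.natAbs ≠ 0 := by simp [hc, hm]
    exact mul_eq_one.mp (le_antisymm h1 (Nat.one_le_iff_ne_zero.mpr h2))
  have sq_one : ∀ {x : ℤ}, x.natAbs = 1 → x ^ 2 = 1 := fun hx => by
    rw [← Int.natAbs_sq, hx]; norm_num
  have hcop : ∀ {x : ℤ}, x ∣ e → IsCoprime M x := fun hx => hMe.of_isCoprime_of_dvd_right hx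
  by_cases hwodd : Odd w
  · have hNodd : Odd N := by
      have : Odd (N ^ 2) := by
        rw [hN]
        exact hwodd.pow.add_even ((by decide : Even (64 : ℤ)).mul_right _)
      exact (Int.odd_pow' two_ne_zero).mp this
    obtain ⟨a, ha⟩ := hNodd.sub_odd hwodd
    have hb : N + w = (a + w) + (a + w) := by linarith
    have hab : a * (a + w) = (2 * e) ^ 4 := by
      have : (N - w) * (N + w) = 64 * e ^ 4 := by linear_combination hN
      rw [ha, hb] at this
      linarith
    have hw2 : IsCoprime w (2 * e) :=
      (Int.isCoprime_two_right.mpr hwodd).mul_right hwe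
    obtain ⟨r, s, hwrs, hers, hrs⟩ := exists_fourth_powers_of_sub (by linarith) (by linarith) hab
      (by ring) hw2
    have hM2 : M ^ 2 = s ^ 4 - r ^ 4 - u * e ^ 2 := by linarith
    rcases Int.even_or_odd r with hr | hr
    · obtain ⟨ρ, rfl⟩ := hr.two_dvd
      have hsodd : Odd s := Int.isCoprime_two_left.mp hrs.of_mul_left_left
      have he' : e = ρ * s := by linarith
      have hs4 : s ^ 4 % 4 = 1 := by
        have := sq_emod_four_of_odd (x := s ^ 2) hsodd.pow
        rwa [← pow_mul] at this
      have hρe : Even ρ := by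
        by_contra hρ
        rw [Int.not_even_iff_odd] at hρ
        have heodd : Odd e := he' ▸ hρ.mul hsodd
        have h1 := sq_emod_four_of_odd heodd
        have hMe' : Even M := by
          by_contra hM'
          rw [Int.not_even_iff_odd] at hM'
          exact (Int.not_even_iff_odd.mpr hwodd) (hM'.pow.add_odd (huodd.mul heodd.pow))
        have h2 := sq_emod_four_of_even hMe'
        have h3 : u * e ^ 2 % 4 = 3 := by rw [Int.mul_emod, hu, h1]; norm_num
        have h4 : (2 * ρ) ^ 4 = 4 * (4 * ρ ^ 4) := by ring
        omega
      obtain ⟨τ, rfl⟩ := hρe.two_dvd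
      have heven : Even e := ⟨τ * s, by rw [he']; ring⟩
      have hModd : Odd M := Int.isCoprime_two_right.mp (hcop heven.two_dvd)
      obtain ⟨A, hA⟩ : ∃ A, s ^ 2 - 2 * u * τ ^ 2 - M = A + A := by
        have : Even (s ^ 2 - 2 * u * τ ^ 2 - M) :=
          (hsodd.pow.sub_even ⟨u * τ ^ 2, by ring⟩).sub_odd hModd
        exact this
      have hτ : τ ≠ 0 := by rintro rfl; simp_all
      obtain ⟨m, n, rfl, hmn, hsq⟩ := exists_of_factorization (A := A) (B := A + M) (ρ := τ)
        (M := M) (D := 1) (σ := s) hp hτ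
        (by
          have hA' : 4 * (A * (A + M)) = 4 * ((u ^ 2 + 64) * τ ^ 4) := by
            rw [he'] at hM2
            linear_combination (-(A + A) - 2 * M - (s ^ 2 - 2 * u * τ ^ 2 - M)) * hA - hM2
          linarith)
        isCoprime_one_left (hcop ⟨2 * s, by rw [he']; ring⟩) (by ring) (by linarith)
      have := (descend m n (2 * s) s (by rw [he']; ring) hmn hsq).1
      rw [Int.natAbs_mul] at this
      exact absurd (Dvd.intro _ this) (by decide)
    · have hseven : Even s := by
        by_contra hs
        rw [Int.not_even_iff_odd] at hs
        have := hr.mul hs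
        rw [← hers, Int.odd_iff] at this
        omega
      obtain ⟨t, rfl⟩ := hseven.two_dvd
      have he' : e = r * t := by linarith
      have hr0 : r ≠ 0 := by rintro rfl; simp_all
      obtain ⟨m, n, rfl, hmn, hsq⟩ := exists_of_factorization (A := 32 * t ^ 2 - u * r ^ 2 - 8 * M)
        (B := 32 * t ^ 2 - u * r ^ 2 + 8 * M) (ρ := r) (M := M) (D := 2 ^ 4) (σ := 8 * t) hp hr0
        (by rw [he'] at hM2; linear_combination -64 * hM2)
        (by
          refine (Int.isCoprime_two_left.mpr ?_).pow_left
          exact (Even.sub_odd ⟨16 * t ^ 2, by ring⟩ (huodd.mul hr.pow)).sub_even ⟨4 * M, by ring⟩)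
        (hcop ⟨t, he'⟩) (by ring) (by ring)
      obtain ⟨ht, hm⟩ := descend m n t (8 * t) (by rw [he']; ring) hmn hsq
      have hn0 : n ≠ 0 := right_ne_zero_of_mul hr0
      have hn1 : 0 < n ^ 2 := by positivity
      rw [mul_pow, sq_one ht, sq_one hm] at hsq
      have hn2 : n ^ 2 = 1 := by nlinarith [sq_nonneg (1 + u * n ^ 2)]
      have hn4 : n ^ 4 = 1 := by rw [show n ^ 4 = (n ^ 2) ^ 2 by ring, hn2]; norm_num
      rw [hn2, hn4] at hsq
      have hu1 : u = -1 := by nlinarith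
      rw [hu1] at hp
      norm_num [Int.prime_iff_natAbs_prime] at hp
  · have hweven : Even w := Int.not_odd_iff_even.mp hwodd
    have heodd : Odd e := by
      by_contra he'
      rw [Int.not_odd_iff_even] at he'
      have hModd : Odd M := Int.isCoprime_two_right.mp (hcop he'.two_dvd)
      exact hwodd (hModd.pow.add_even ((he'.pow_of_ne_zero two_ne_zero).mul_left u))
    have hModd : Odd M := by
      by_contra hM'
      rw [Int.not_odd_iff_even] at hM'
      exact hwodd ((hM'.pow_of_ne_zero two_ne_zero).add_odd (huodd.mul heodd.pow))
    obtain ⟨v, hv⟩ : 4 ∣ w := by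
      have h1 := sq_emod_four_of_odd heodd
      have h2 := sq_emod_four_of_odd hModd
      have h3 : u * e ^ 2 % 4 = 3 := by rw [Int.mul_emod, hu, h1]; norm_num
      omega
    obtain ⟨L, hL⟩ : 4 ∣ N := by
      have : (4 : ℤ) ^ 2 ∣ N ^ 2 := ⟨v ^ 2 + 4 * e ^ 4, by rw [hN, hv]; ring⟩
      exact (Int.pow_dvd_pow_iff two_ne_zero).mp this
    have hLv : L ^ 2 = v ^ 2 + 4 * e ^ 4 := by
      rw [hv, hL] at hN
      linarith
    obtain ⟨a, ha⟩ : Even (L - v) := by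
      have : Even (L ^ 2 - v ^ 2) := ⟨2 * e ^ 4, by rw [hLv]; ring⟩
      rwa [Int.even_sub, Int.even_pow' two_ne_zero, Int.even_pow' two_ne_zero, ← Int.even_sub]
        at this
    have hab : a * (a + v) = e ^ 4 := by
      have hL' : L = a + a + v := by linarith
      rw [hL'] at hLv
      linarith
    obtain ⟨r, s, hvrs, hers, hrs⟩ := exists_fourth_powers_of_sub (by linarith) (by linarith) hab
      (by ring) (hv ▸ hwe).of_mul_left_right
    have hM2 : M ^ 2 = 4 * (s ^ 4 - r ^ 4) - u * (r * s) ^ 2 := by rw [← hers]; linarith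
    have hr0 : r ≠ 0 := by rintro rfl; simp_all
    have hrodd : Odd r := (Int.odd_mul.mp (hers ▸ heodd)).1
    obtain ⟨m, n, rfl, hmn, hsq⟩ := exists_of_factorization (A := 8 * s ^ 2 - u * r ^ 2 - 4 * M)
      (B := 8 * s ^ 2 - u * r ^ 2 + 4 * M) (ρ := r) (M := M) (D := 2 ^ 3) (σ := 4 * s) hp hr0
      (by linear_combination -16 * hM2)
      (by
        refine (Int.isCoprime_two_left.mpr ?_).pow_left
        exact (Even.sub_odd ⟨4 * s ^ 2, by ring⟩ (huodd.mul hrodd.pow)).sub_even ⟨2 * M, by ring⟩)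
      (hcop ⟨s, hers⟩) (by ring) (by ring)
    obtain ⟨hs, -⟩ := descend m n s (4 * s) (by rw [hers]; ring) hmn hsq
    have hn0 : n ≠ 0 := right_ne_zero_of_mul hr0
    have hn4 : 0 < n ^ 4 := by positivity
    rw [mul_pow, sq_one hs] at hsq
    nlinarith [sq_nonneg (m ^ 2 + u * n ^ 2)]

/-- The curve `Y² = t (t² + 2 u t + u² + 64)` has no rational point with `t ≠ 0`. -/
theorem eq_zero_of_sq_eq_cubic {u : ℤ} (hu : u % 4 = 3) (hp : Prime (u ^ 2 + 64)) {t Y : ℚ}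
    (h : Y ^ 2 = t * (t ^ 2 + 2 * u * t + (u ^ 2 + 64))) : t = 0 := by
  by_contra ht
  have hdescent := fun M e N he => no_solution_quartic hu hp _ M e N rfl he
  set p := u ^ 2 + 64 with hpdef
  have hquad : 0 < t ^ 2 + 2 * u * t + (u ^ 2 + 64) := by nlinarith [sq_nonneg (t + u)]
  have htpos : 0 < t := by
    refine lt_of_le_of_ne ?_ (Ne.symm ht)
    by_contra! hneg
    nlinarith [sq_nonneg Y, mul_neg_of_neg_of_pos hneg hquad]
  obtain ⟨a, ha⟩ : ∃ a, a = t.num := ⟨_, rfl⟩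
  obtain ⟨b, hb⟩ : ∃ b : ℤ, b = t.den := ⟨_, rfl⟩
  have ha0 : 0 < a := ha ▸ Rat.num_pos.mpr htpos
  have hb0 : 0 < b := hb ▸ Int.natCast_pos.mpr t.den_pos
  have hab : IsCoprime a b := ha ▸ hb ▸ t.isCoprime_num_den
  have htab : t = a / b := by rw [ha, hb]; exact (Rat.num_div_den t).symm
  have hbQ : (b : ℚ) ≠ 0 := by exact_mod_cast hb0.ne'
  obtain ⟨Z, hZ⟩ : ∃ Z : ℤ, Z ^ 2 = b * (a * (a ^ 2 + 2 * u * a * b + p * b ^ 2)) := by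
    have : IsSquare ((b * (a * (a ^ 2 + 2 * u * a * b + p * b ^ 2)) : ℤ) : ℚ) := by
      refine ⟨Y * b ^ 2, ?_⟩
      have : Y * b ^ 2 * (Y * b ^ 2) = Y ^ 2 * b ^ 4 := by ring
      rw [this, h, htab, hpdef]
      push_cast
      field_simp
    obtain ⟨Z, hZ⟩ := Rat.isSquare_intCast_iff.mp this
    exact ⟨Z, by rw [hZ, sq]⟩
  have hQb : IsCoprime (a ^ 2 + 2 * u * a * b + p * b ^ 2) b := by
    have := (hab.pow_left (m := 2)).add_mul_left_left (2 * u * a + p * b)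
    rwa [show a ^ 2 + b * (2 * u * a + p * b) = a ^ 2 + 2 * u * a * b + p * b ^ 2 by ring] at this
  obtain ⟨e, -, rfl⟩ := exists_sq_of_coprime_mul hb0 (hab.mul_left hQb).symm hZ.symm
  have he0 : e ≠ 0 := by rintro rfl; simp at hb0
  have hae : IsCoprime a e := (IsCoprime.pow_right_iff two_pos).mp hab
  obtain ⟨z, rfl⟩ : e ∣ Z := by
    rw [← Int.pow_dvd_pow_iff two_ne_zero, hZ]
    exact dvd_mul_right _ _
  have hz : a * (a ^ 2 + 2 * u * a * e ^ 2 + p * (e ^ 2) ^ 2) = z ^ 2 :=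
    mul_left_cancel₀ (pow_ne_zero 2 he0) (by rw [← hZ]; ring)
  have hp0 : 0 < p := by positivity
  by_cases hpa : p ∣ a
  · obtain ⟨c, rfl⟩ := hpa
    have hc0 : 0 < c := pos_of_mul_pos_right ha0 hp0.le
    have hce : IsCoprime c e := hae.of_mul_left_right
    obtain ⟨y, rfl⟩ : p ∣ z := by
      refine hp.dvd_of_dvd_pow (n := 2) ?_
      rw [← hz, mul_assoc]
      exact dvd_mul_right _ _
    have hy : c * (p * c ^ 2 + 2 * u * c * e ^ 2 + (e ^ 2) ^ 2) = y ^ 2 :=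
      mul_left_cancel₀ (pow_ne_zero 2 hp.ne_zero) (by linear_combination hz)
    have hcQ : IsCoprime c (p * c ^ 2 + 2 * u * c * e ^ 2 + (e ^ 2) ^ 2) := by
      have := (hce.pow_right (n := 4)).add_mul_left_right (p * c + 2 * u * e ^ 2)
      rwa [show e ^ 4 + c * (p * c + 2 * u * e ^ 2)
        = p * c ^ 2 + 2 * u * c * e ^ 2 + (e ^ 2) ^ 2 by ring] at this
    obtain ⟨m, -, rfl⟩ := exists_sq_of_coprime_mul hc0 hcQ hy
    have hm0 : m ≠ 0 := by rintro rfl; simp at hc0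
    obtain ⟨n, rfl⟩ : m ∣ y := by
      rw [← Int.pow_dvd_pow_iff two_ne_zero, ← hy]
      exact dvd_mul_right _ _
    have hn := mul_left_cancel₀ (pow_ne_zero 2 hm0) (hy.trans (mul_pow m n 2))
    exact hdescent e m n hm0 he0 ((IsCoprime.pow_left_iff two_pos).mp hce).symm
      (by rw [← hn, hpdef]; ring)
  · have haQ : IsCoprime a (a ^ 2 + 2 * u * a * e ^ 2 + p * (e ^ 2) ^ 2) := by
      have hap : IsCoprime a p := (hp.irreducible.coprime_iff_not_dvd.mpr hpa).symm
      have := (hap.mul_right (hae.pow_right (n := 4))).add_mul_left_right (a + 2 * u * e ^ 2)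
      rwa [show p * e ^ 4 + a * (a + 2 * u * e ^ 2)
        = a ^ 2 + 2 * u * a * e ^ 2 + p * (e ^ 2) ^ 2 by ring] at this
    obtain ⟨m, -, rfl⟩ := exists_sq_of_coprime_mul ha0 haQ hz
    have hm0 : m ≠ 0 := by rintro rfl; simp at ha0
    obtain ⟨n, rfl⟩ : m ∣ z := by
      rw [← Int.pow_dvd_pow_iff two_ne_zero, ← hz]
      exact dvd_mul_right _ _
    have hn := mul_left_cancel₀ (pow_ne_zero 2 hm0) (hz.trans (mul_pow m n 2))
    exact hdescent m e n he0 hm0 ((IsCoprime.pow_left_iff two_pos).mp hae)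
      (by rw [← hn, hpdef]; ring)

/-- The rational point of order two on the Neumann–Setzer curve. -/
theorem NeumannSetzerE₀_nonsingular (u : ℤ) :
    (NeumannSetzerE₀ u).Nonsingular ((u : ℚ) / 4) (-((u : ℚ) / 8)) := by
  rw [WeierstrassCurve.Affine.nonsingular_iff', WeierstrassCurve.Affine.equation_iff]
  simp only [NeumannSetzerE₀]
  refine ⟨by ring, Or.inl ?_⟩
  nlinarith [sq_nonneg (u : ℚ)]

/-- Every affine rational point of the curve is the point of order two. -/
theorem NeumannSetzerE₀_eq_of_equation {u : ℤ} (hu : u % 4 = 3) (hp : Prime (u ^ 2 + 64))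
    {x y : ℚ} (h : (NeumannSetzerE₀ u).Equation x y) : x = u / 4 ∧ y = -((u : ℚ) / 8) := by
  rw [WeierstrassCurve.Affine.equation_iff] at h
  simp only [NeumannSetzerE₀] at h
  have hx : 4 * x - u = 0 := eq_zero_of_sq_eq_cubic hu hp (Y := 8 * y + 4 * x)
    (by linear_combination 64 * h)
  have hx' : x = u / 4 := by linarith
  refine ⟨hx', ?_⟩
  have hy : (y + u / 8) ^ 2 = 0 := by
    rw [hx'] at h
    linear_combination h
  have := pow_eq_zero_iff two_ne_zero |>.mp hy
  linarith

theorem stmt_5 (u : ℤ) (hu : u % 4 = 3) (hp : Prime (u ^ 2 + 64)) :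
    Nonempty ((NeumannSetzerE₀ u).Point ≃+ ZMod 2) := by
  have hcard : Nat.card (NeumannSetzerE₀ u).Point = 2 := by
    rw [Nat.card_eq_two_iff]
    refine ⟨.zero, .some _ _ (NeumannSetzerE₀_nonsingular u), nofun,
      Set.eq_univ_of_forall ?_⟩
    rintro (_ | ⟨x, y, hxy⟩)
    · exact Or.inl rfl
    · obtain ⟨rfl, rfl⟩ := NeumannSetzerE₀_eq_of_equation hu hp hxy.1
      exact Or.inr rfl
  have : Fact (Nat.Prime 2) := ⟨Nat.prime_two⟩
  have hcyc := isAddCyclic_of_prime_card hcard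
  exact ⟨addEquivOfAddCyclicCardEq (by rw [hcard, Nat.card_zmod])⟩
end

section
/- Let u be an integer with u ≡ 3 (mod 4) such that p = u² + 64 is prime. Then the group of rational points E₁(ℚ) of the Neumann–Setzer curve E₁ : y² + xy = x³ − ((u+1)/4)x² − x is isomorphic to ℤ/2ℤ. -/
/-- The Neumann–Setzer curve `E₁ : y² + xy = x³ − ((u+1)/4)x² − x` over `ℚ`,
in affine coordinates. -/
noncomputable def NeumannSetzerE₁ (u : ℤ) : WeierstrassCurve.Affine ℚ :=
  { a₁ := 1, a₂ := -(((u : ℚ) + 1) / 4), a₃ := 0, a₄ := -1, a₆ := 0 }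

theorem Int.eq_sq_or_eq_neg_sq_of_mul_add_eq_mul {n D c : ℤ} (hc : IsCoprime D c)
    (h : n * (n + D) = D * c) : ∃ g : ℤ, D = g ^ 2 ∨ D = -g ^ 2 := by
  rcases eq_or_ne D 0 with rfl | hD
  · exact ⟨0, by simp⟩
  obtain ⟨g, n', D', hg, hcop, hn, hD'⟩ :
      ∃ g n' D' : ℤ, g ≠ 0 ∧ IsCoprime n' D' ∧ n = g * n' ∧ D = g * D' := by
    obtain ⟨n', D', hcop, hn, hD'⟩ := Int.exists_gcd_one (m := n) (n := D)
      (Int.gcd_pos_of_ne_zero_right _ hD)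
    exact ⟨Int.gcd n D, n', D', by exact_mod_cast (Int.gcd_pos_of_ne_zero_right n hD).ne',
      Int.isCoprime_iff_gcd_eq_one.mpr hcop, by rw [mul_comm]; exact hn,
      by rw [mul_comm]; exact hD'⟩
  subst hn hD'
  have h1 : g * (n' * (n' + D')) = D' * c := by
    apply mul_left_cancel₀ hg
    linear_combination h
  have hcop' : IsCoprime D' (n' * (n' + D')) := by
    refine hcop.symm.mul_right ?_
    simpa using hcop.symm.add_mul_left_right 1
  have hd1 : D' ∣ g := hcop'.dvd_of_dvd_mul_right (h1 ▸ dvd_mul_right _ _)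
  have hd2 : g ∣ D' := (hc.of_mul_left_left).dvd_of_dvd_mul_right (h1 ▸ dvd_mul_right _ _)
  refine ⟨g, ?_⟩
  rcases Int.associated_iff.mp (associated_of_dvd_dvd hd1 hd2) with rfl | rfl
  · left; ring
  · right; ring

theorem Rat.exists_int_eq_of_sq_eq_intCast {q : ℚ} {z : ℤ} (h : q ^ 2 = z) : ∃ n : ℤ, q = n := by
  obtain ⟨n, hn⟩ := Rat.isSquare_intCast_iff.mp (⟨q, by rw [← h, sq]⟩ : IsSquare (z : ℚ))
  have : q ^ 2 = (n : ℚ) ^ 2 := by rw [h, hn]; push_cast; ring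
  rcases sq_eq_sq_iff_eq_or_eq_neg.mp this with h | h
  · exact ⟨n, h⟩
  · exact ⟨-n, by simpa using h⟩

theorem isCoprime_mul_num_den_quadratic {m d : ℤ} (h : IsCoprime m d) (a : ℤ) :
    IsCoprime (d * m) (m ^ 2 - a * m * d - d ^ 2) := by
  refine IsCoprime.mul_left ?_ ?_
  · rw [show m ^ 2 - a * m * d - d ^ 2 = m ^ 2 + d * (-a * m - d) by ring]
    exact (h.symm.pow_right (n := 2)).add_mul_left_right (-a * m - d)
  · rw [show m ^ 2 - a * m * d - d ^ 2 = -d ^ 2 + m * (m - a * d) by ring]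
    exact (h.pow_right (n := 2)).neg_right.add_mul_left_right (m - a * d)

theorem exists_eq_sq_or_eq_neg_sq_of_equation {a : ℤ} {x y : ℚ}
    (h : y ^ 2 + x * y = x ^ 3 - a * x ^ 2 - x) : ∃ s : ℚ, x = s ^ 2 ∨ x = -s ^ 2 := by
  set m := x.num with hm
  set d : ℤ := (x.den : ℤ) with hd
  have hd0 : (d : ℚ) ≠ 0 := by simp [hd]
  have hcop : IsCoprime m d := by
    rw [Int.isCoprime_iff_gcd_eq_one]; exact x.reduced
  have hx : x = m / d := by simp [hm, hd, Rat.num_div_den]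
  have hxd : x * d = m := by rw [hx]; field_simp
  have hsq : (d ^ 2 * (2 * y + x)) ^ 2 =
      (((m * d) ^ 2 + 4 * (d * m * (m ^ 2 - a * m * d - d ^ 2)) : ℤ) : ℚ) := by
    push_cast
    rw [← hxd]
    linear_combination (4 * (d : ℚ) ^ 4) * h
  obtain ⟨k, hk⟩ := Rat.exists_int_eq_of_sq_eq_intCast hsq
  rw [hk] at hsq
  have hk2 : k ^ 2 = (m * d) ^ 2 + 4 * (d * m * (m ^ 2 - a * m * d - d ^ 2)) := by
    exact_mod_cast hsq
  have hpar : Even (k - m * d) := by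
    have : Even (k ^ 2 - (m * d) ^ 2) := ⟨2 * (d * m * (m ^ 2 - a * m * d - d ^ 2)), by
      rw [hk2]; ring⟩
    have h2 : (k ^ 2 - (m * d) ^ 2) = (k - m * d) * (k + m * d) := by ring
    rw [h2, Int.even_mul] at this
    rcases this with h | h
    · exact h
    · grind
  obtain ⟨n, hn⟩ := hpar
  have hkn : k = 2 * n + m * d := by linarith
  obtain ⟨g, hg⟩ := Int.eq_sq_or_eq_neg_sq_of_mul_add_eq_mul
    (isCoprime_mul_num_den_quadratic hcop a) (n := n) (by
      rw [hkn] at hk2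
      linarith)
  refine ⟨g / d, ?_⟩
  rcases hg with hg | hg
  · left
    have : (d * m : ℚ) = g ^ 2 := by exact_mod_cast hg
    rw [hx]; field_simp; linarith
  · right
    have : (d * m : ℚ) = -g ^ 2 := by exact_mod_cast hg
    rw [hx]; field_simp; linarith

theorem isSquare_of_not_dvd_num {p u : ℤ} (hp : Prime p) {A w : ℚ} (hA : 0 < A)
    (h : A ^ 2 + 2 * u * A + p = A * w ^ 2) (hpA : ¬ p ∣ A.num) : IsSquare A := by
  set k := A.num with hk
  set l : ℤ := (A.den : ℤ) with hl
  have hl0 : (l : ℚ) ≠ 0 := by simp [hl]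
  have hl0' : 0 < l := by simp [hl, A.pos]
  have hk0 : 0 < k := Rat.num_pos.mpr hA
  have hcop : IsCoprime k l := by
    rw [Int.isCoprime_iff_gcd_eq_one]; exact A.reduced
  have hx : A = k / l := by simp [hk, hl, Rat.num_div_den]
  have hxd : A * l = k := by rw [hx]; field_simp
  have hsq : (l * k * w) ^ 2 = ((l * k * (k ^ 2 + 2 * u * k * l + p * l ^ 2) : ℤ) : ℚ) := by
    push_cast
    rw [← hxd]
    linear_combination (-(l : ℚ) ^ 4 * A) * h
  obtain ⟨n, hn⟩ := Rat.exists_int_eq_of_sq_eq_intCast hsq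
  rw [hn] at hsq
  have hn2 : l * k * (k ^ 2 + 2 * u * k * l + p * l ^ 2) = n ^ 2 := by exact_mod_cast hsq.symm
  have hpk : IsCoprime k p := ((Prime.coprime_iff_not_dvd hp).mpr hpA).symm
  have hc : IsCoprime (l * k) (k ^ 2 + 2 * u * k * l + p * l ^ 2) := by
    refine IsCoprime.mul_left ?_ ?_
    · rw [show k ^ 2 + 2 * u * k * l + p * l ^ 2 = k ^ 2 + l * (2 * u * k + p * l) by ring]
      exact (hcop.symm.pow_right (n := 2)).add_mul_left_right (2 * u * k + p * l)
    · rw [show k ^ 2 + 2 * u * k * l + p * l ^ 2 = p * l ^ 2 + k * (k + 2 * u * l) by ring]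
      exact (hpk.mul_right (hcop.pow_right (n := 2))).add_mul_left_right (k + 2 * u * l)
  obtain ⟨g, hg⟩ := Int.sq_of_isCoprime hc hn2
  rcases hg with hg | hg
  · refine ⟨g / l, ?_⟩
    have : (l * k : ℚ) = g ^ 2 := by exact_mod_cast hg
    rw [hx]; field_simp; linarith
  · nlinarith [mul_pos hl0' hk0, sq_nonneg g]

theorem isSquare_or_isSquare_of_mul_eq_prime {p u : ℤ} (hp : Prime p) {A B w : ℚ} (hA : 0 < A)
    (hB : 0 < B) (hAB : A * B = p) (h : A + B + 2 * u = w ^ 2) : IsSquare A ∨ IsSquare B := by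
  by_cases hpA : p ∣ A.num
  · right
    refine isSquare_of_not_dvd_num (u := u) (w := w) hp hB
      (by linear_combination B * h - hAB) fun hpB => ?_
    have h1 : A.num * B.num = p * (A.den * B.den) := by
      have : (A.num * B.num : ℚ) = p * (A.den * B.den) := by
        rw [← hAB, ← Rat.mul_den_eq_num A, ← Rat.mul_den_eq_num B]
        ring
      exact_mod_cast this
    obtain ⟨i, hi⟩ := hpA
    obtain ⟨j, hj⟩ := hpB
    have h2 : p * (i * j) = A.den * B.den := by
      apply mul_left_cancel₀ hp.ne_zero
      rw [← h1, hi, hj]; ring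
    rcases hp.dvd_or_dvd (h2 ▸ dvd_mul_right _ _) with h3 | h3
    · have hc : IsCoprime A.num A.den := Int.isCoprime_iff_gcd_eq_one.mpr A.reduced
      exact hp.not_isUnit (hc.isUnit_of_dvd' ⟨i, hi⟩ h3)
    · have hc : IsCoprime B.num B.den := Int.isCoprime_iff_gcd_eq_one.mpr B.reduced
      exact hp.not_isUnit (hc.isUnit_of_dvd' ⟨j, hj⟩ h3)
  · exact .inl (isSquare_of_not_dvd_num (u := u) (w := w) hp hA
      (by linear_combination A * h - hAB) hpA)

theorem Rat.dvd_den_of_mul_eq {x : ℚ} {N D k : ℤ} (hk : IsCoprime k N) (hkD : k ∣ D)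
    (h : x * D = N) : k ∣ x.den := by
  have h1 : x.num * D = N * x.den := by
    have : (x.num * D : ℚ) = N * x.den := by
      rw [← h, ← Rat.mul_den_eq_num x]; ring
    exact_mod_cast this
  exact hk.dvd_of_dvd_mul_left (h1 ▸ hkD.mul_left _)

theorem Rat.two_dvd_num_of_mul_eq {x : ℚ} {N D : ℤ} (hN : Even N) (hD : Odd D)
    (h : x * D = N) : Even x.num := by
  have h1 : x.num * D = N * x.den := by
    have : (x.num * D : ℚ) = N * x.den := by
      rw [← h, ← Rat.mul_den_eq_num x]; ring
    exact_mod_cast this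
  have h2 : Even (x.num * D) := h1 ▸ hN.mul_right _
  rcases Int.even_mul.mp h2 with h | h
  · exact h
  · exact absurd hD (Int.not_odd_iff_even.mpr h)

theorem duplication_num_den {u : ℤ} {x z : ℚ}
    (h : z * (4 * x ^ 3 - u * x ^ 2 - 4 * x) = (x ^ 2 + 1) ^ 2) :
    z * ((x.den * x.num * (4 * x.num ^ 2 - u * x.num * x.den - 4 * x.den ^ 2) : ℤ) : ℚ) =
      (((x.num ^ 2 + x.den ^ 2) ^ 2 : ℤ) : ℚ) := by
  push_cast
  rw [← Rat.mul_den_eq_num x]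
  linear_combination (x.den : ℚ) ^ 4 * h

theorem two_pow_succ_dvd_den_of_duplication {u : ℤ} {x z : ℚ}
    (h : z * (4 * x ^ 3 - u * x ^ 2 - 4 * x) = (x ^ 2 + 1) ^ 2) {n : ℕ} (hn : n ≠ 0)
    (hx : 2 ^ n ∣ (x.den : ℤ)) : 2 ^ (n + 1) ∣ (z.den : ℤ) := by
  have h2 : (2 : ℤ) ∣ x.den := (dvd_pow_self 2 hn).trans hx
  have hc : IsCoprime x.num x.den := Int.isCoprime_iff_gcd_eq_one.mpr x.reduced
  refine Rat.dvd_den_of_mul_eq ?_ ?_ (duplication_num_den h)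
  · refine IsCoprime.pow_left (IsCoprime.pow_right ?_)
    have h3 : IsCoprime (2 : ℤ) x.num := (hc.of_isCoprime_of_dvd_right h2).symm
    obtain ⟨e, he⟩ := h2
    rw [he, show x.num ^ 2 + (2 * e) ^ 2 = x.num ^ 2 + 2 * (2 * e ^ 2) by ring]
    exact h3.pow_right.add_mul_left_right _
  · rw [pow_succ]
    obtain ⟨e, he⟩ := h2
    refine mul_dvd_mul (hx.mul_right _) ⟨2 * x.num ^ 2 - u * x.num * e - 2 * x.den ^ 2, ?_⟩
    rw [he]; ring

theorem two_dvd_den_of_duplication {u : ℤ} {x z : ℚ}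
    (h : z * (4 * x ^ 3 - u * x ^ 2 - 4 * x) = (x ^ 2 + 1) ^ 2) (hx : Even x.num) :
    2 ∣ (z.den : ℤ) := by
  have hc : IsCoprime x.num x.den := Int.isCoprime_iff_gcd_eq_one.mpr x.reduced
  have h2 := hx.two_dvd
  refine Rat.dvd_den_of_mul_eq ?_ ?_ (duplication_num_den h)
  · refine IsCoprime.pow_right ?_
    have h3 : IsCoprime (2 : ℤ) x.den := hc.of_isCoprime_of_dvd_left h2
    obtain ⟨e, he⟩ := h2
    rw [he, show (2 * e) ^ 2 + (x.den : ℤ) ^ 2 = x.den ^ 2 + 2 * (2 * e ^ 2) by ring]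
    exact h3.pow_right.add_mul_left_right _
  · exact (h2.mul_left _).mul_right _

theorem even_num_of_duplication {u : ℤ} (hu : Odd u) {x z : ℚ}
    (h : z * (4 * x ^ 3 - u * x ^ 2 - 4 * x) = (x ^ 2 + 1) ^ 2) (hx : Odd x.num)
    (hd : Odd (x.den : ℤ)) : Even z.num := by
  refine Rat.two_dvd_num_of_mul_eq ?_ ?_ (duplication_num_den h)
  · exact (hx.pow.add_odd hd.pow).pow_of_ne_zero two_ne_zero
  · refine (hd.mul hx).mul ?_
    have h1 : Odd (u * x.num * x.den) := (hu.mul hx).mul hd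
    have : 4 * x.num ^ 2 - u * x.num * x.den - 4 * x.den ^ 2 =
      2 * (2 * x.num ^ 2 - 2 * x.den ^ 2) - u * x.num * x.den := by ring
    rw [this]
    exact (even_two_mul _).sub_odd h1

namespace NeumannSetzerE₁

theorem equation_iff {u a : ℤ} (ha : u = 4 * a - 1) {x y : ℚ} :
    (NeumannSetzerE₁ u).Equation x y ↔ y ^ 2 + x * y = x ^ 3 - a * x ^ 2 - x := by
  rw [WeierstrassCurve.Affine.equation_iff]
  subst ha
  simp only [NeumannSetzerE₁]
  push_cast
  constructor <;> intro h <;> linear_combination h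

theorem Δ_ne_zero (u : ℤ) : (NeumannSetzerE₁ u).Δ ≠ 0 := by
  have : (NeumannSetzerE₁ u).Δ = u ^ 2 + 64 := by
    simp only [NeumannSetzerE₁, WeierstrassCurve.Δ, WeierstrassCurve.b₂, WeierstrassCurve.b₄,
      WeierstrassCurve.b₆, WeierstrassCurve.b₈]
    ring
  rw [this]; positivity

theorem nonsingular_iff {u a : ℤ} (ha : u = 4 * a - 1) {x y : ℚ} :
    (NeumannSetzerE₁ u).Nonsingular x y ↔ y ^ 2 + x * y = x ^ 3 - a * x ^ 2 - x := by
  rw [← WeierstrassCurve.Affine.equation_iff_nonsingular_of_Δ_ne_zero (Δ_ne_zero u),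
    equation_iff ha]

theorem negY_eq (u : ℤ) (x y : ℚ) : (NeumannSetzerE₁ u).negY x y = -y - x := by
  simp [WeierstrassCurve.Affine.negY, NeumannSetzerE₁]

theorem nonsingular_zero (u : ℤ) : (NeumannSetzerE₁ u).Nonsingular 0 0 := by
  rw [← WeierstrassCurve.Affine.equation_iff_nonsingular_of_Δ_ne_zero (Δ_ne_zero u)]
  simp [NeumannSetzerE₁]

open WeierstrassCurve.Affine

/-- The rational point `(0, 0)` of order two. -/
noncomputable def twoTorsionPoint (u : ℤ) : (NeumannSetzerE₁ u).Point :=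
  .some 0 0 (nonsingular_zero u)

theorem twoTorsionPoint_ne_zero (u : ℤ) : twoTorsionPoint u ≠ 0 :=
  Point.some_ne_zero _

theorem two_nsmul_twoTorsionPoint (u : ℤ) : 2 • twoTorsionPoint u = 0 := by
  rw [two_nsmul]
  exact Point.add_self_of_Y_eq (by rw [negY_eq]; ring)

theorem two_nsmul_some_eq_zero {u : ℤ} {x y : ℚ} (h : (NeumannSetzerE₁ u).Nonsingular x y)
    (hy : 2 * y + x = 0) : 2 • Point.some x y h = 0 := by
  rw [two_nsmul]
  exact Point.add_self_of_Y_eq (by rw [negY_eq]; linear_combination hy)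

theorem exists_two_nsmul_some {u : ℤ} (hu : u % 4 = 3) {x y : ℚ}
    (h : (NeumannSetzerE₁ u).Nonsingular x y) (hy : 2 * y + x ≠ 0) :
    ∃ (z w : ℚ) (h' : (NeumannSetzerE₁ u).Nonsingular z w), 2 • Point.some x y h = .some z w h' ∧
      z * (2 * y + x) ^ 2 = (x ^ 2 + 1) ^ 2 := by
  obtain ⟨a, ha⟩ : ∃ a, u = 4 * a - 1 := ⟨(u + 1) / 4, by omega⟩
  have hy' : y ≠ (NeumannSetzerE₁ u).negY x y := by
    rw [negY_eq]; contrapose! hy; linear_combination hy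
  refine ⟨_, _, _, by rw [two_nsmul]; exact Point.add_self_of_Y_ne hy', ?_⟩
  have he := (nonsingular_iff ha).mp h
  rw [slope_of_Y_ne rfl hy', negY_eq, addX]
  have h3 : y - (-y - x) = 2 * y + x := by ring
  rw [h3]
  subst ha
  simp only [NeumannSetzerE₁]
  push_cast
  field_simp
  linear_combination 16 * (4 * (a : ℚ) - 8 * x - 1) * he

theorem sq_two_mul_add {u : ℤ} (hu : u % 4 = 3) {x y : ℚ}
    (h : (NeumannSetzerE₁ u).Nonsingular x y) :
    (2 * y + x) ^ 2 = 4 * x ^ 3 - u * x ^ 2 - 4 * x := by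
  obtain ⟨a, ha⟩ : ∃ a, u = 4 * a - 1 := ⟨(u + 1) / 4, by omega⟩
  have he := (nonsingular_iff ha).mp h
  rw [ha]
  push_cast
  linear_combination 4 * he

theorem exists_some_add_twoTorsionPoint {u : ℤ} (hu : u % 4 = 3) {x y : ℚ}
    (h : (NeumannSetzerE₁ u).Nonsingular x y) (hx : x ≠ 0) :
    ∃ (w : ℚ) (h' : (NeumannSetzerE₁ u).Nonsingular (-1 / x) w),
      Point.some x y h + twoTorsionPoint u = .some (-1 / x) w h' := by
  have hX : (NeumannSetzerE₁ u).addX x 0 ((NeumannSetzerE₁ u).slope x 0 y 0) = -1 / x := by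
    obtain ⟨a, ha⟩ : ∃ a, u = 4 * a - 1 := ⟨(u + 1) / 4, by omega⟩
    have he := (nonsingular_iff ha).mp h
    rw [slope_of_X_ne hx, addX]
    subst ha
    simp only [NeumannSetzerE₁]
    push_cast
    field_simp
    linear_combination 4 * x * he
  have := Point.add_of_X_ne (h₁ := h) (h₂ := nonsingular_zero u) hx
  have key : ∀ (z w : ℚ) (h' : (NeumannSetzerE₁ u).Nonsingular z w), z = -1 / x →
      Point.some x y h + twoTorsionPoint u = .some z w h' →
      ∃ (w : ℚ) (h' : (NeumannSetzerE₁ u).Nonsingular (-1 / x) w),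
        Point.some x y h + twoTorsionPoint u = .some (-1 / x) w h' := by
    rintro z w h' rfl hz
    exact ⟨w, h', hz⟩
  exact key _ _ _ hX this

theorem exists_two_nsmul_eq_of_sq {u : ℤ} (hu : u % 4 = 3) (hp : Prime (u ^ 2 + 64)) {s y : ℚ}
    (hs : s ≠ 0) (h : (NeumannSetzerE₁ u).Nonsingular (s ^ 2) y) :
    ∃ R, Point.some (s ^ 2) y h = 2 • R := by
  -- `t ^ 2 = S ^ 4 - u * S ^ 2 - 16` for `S = 2 * s`
  obtain ⟨t, W, ht, hW⟩ : ∃ t W : ℚ, t ^ 2 = 16 * s ^ 4 - 4 * u * s ^ 2 - 16 ∧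
      8 * s ^ 2 - u + 2 * t = W ^ 2 := by
    have he := sq_two_mul_add hu h
    set T : ℚ := 2 * (2 * y + s ^ 2) / s with hT
    have hT2 : T ^ 2 = 16 * s ^ 4 - 4 * u * s ^ 2 - 16 := by
      rw [hT, div_pow, mul_pow, he]; field_simp; ring
    have hAB : (8 * s ^ 2 - u + 2 * T) * (8 * s ^ 2 - u - 2 * T) = ((u ^ 2 + 64 : ℤ) : ℚ) := by
      push_cast
      linear_combination -4 * hT2
    have hpos : 0 < 8 * s ^ 2 - (u : ℚ) := by
      by_contra! hneg
      nlinarith [sq_nonneg T, sq_pos_of_ne_zero hs]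
    have hAB' : 0 < (8 * s ^ 2 - u + 2 * T) * (8 * s ^ 2 - u - 2 * T) := by
      rw [hAB]; push_cast; positivity
    have hA : 0 < 8 * s ^ 2 - u + 2 * T := by
      by_contra! hA
      nlinarith
    have hB : 0 < 8 * s ^ 2 - u - 2 * T := (pos_iff_pos_of_mul_pos hAB').mp hA
    rcases isSquare_or_isSquare_of_mul_eq_prime (u := u) (w := 4 * s) hp hA hB hAB (by ring)
      with ⟨W, hW⟩ | ⟨W, hW⟩
    · exact ⟨T, W, hT2, by rw [hW, sq]⟩
    · exact ⟨-T, W, by rw [neg_sq, hT2], by linear_combination hW⟩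
  have hW0 : W ≠ 0 := by
    rintro rfl
    have : (8 * s ^ 2 - u) ^ 2 - 4 * t ^ 2 = (u : ℚ) ^ 2 + 64 := by rw [ht]; ring
    have h0 : (u : ℚ) ^ 2 + 64 = 0 := by
      rw [← this]; linear_combination (8 * s ^ 2 - u - 2 * t) * hW
    have h1 : 0 < (u : ℚ) ^ 2 + 64 := by positivity
    exact absurd h0 (ne_of_gt h1)
  -- the roots of `X ^ 2 - (u + W ^ 2) * X - 16` differ by `4 * s * W`
  set X : ℚ := 4 * s ^ 2 + t + 2 * s * W with hX
  have hXeq : X ^ 2 - (u + W ^ 2) * X - 16 = 0 := by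
    have hu' : (u : ℚ) = 8 * s ^ 2 + 2 * t - W ^ 2 := by linear_combination -hW
    rw [hu'] at ht ⊢
    rw [hX]
    linear_combination -ht
  have hX0 : X ≠ 0 := by
    intro h0; rw [h0] at hXeq; norm_num at hXeq
  obtain ⟨a, ha⟩ : ∃ a, u = 4 * a - 1 := ⟨(u + 1) / 4, by omega⟩
  have hR : (NeumannSetzerE₁ u).Nonsingular (X / 4) ((W - 1) * X / 8) := by
    rw [nonsingular_iff ha]
    have hua : (u : ℚ) = 4 * a - 1 := by rw [ha]; push_cast; ring
    rw [hua] at hXeq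
    linear_combination (-X / 64) * hXeq
  have hYR : 2 * ((W - 1) * X / 8) + X / 4 = W * X / 4 := by ring
  obtain ⟨z, w, h', h2R, hz⟩ := exists_two_nsmul_some hu hR
    (by rw [hYR]; exact div_ne_zero (mul_ne_zero hW0 hX0) (by norm_num))
  have hzs : z = s ^ 2 := by
    rw [hYR] at hz
    have h1 : X ^ 2 + 16 = 4 * s * W * X := by
      have : u + W ^ 2 = 2 * X - 4 * s * W := by rw [hX]; linear_combination -hW
      rw [this] at hXeq
      linear_combination -hXeq
    have h2 : ((X / 4) ^ 2 + 1) ^ 2 = s ^ 2 * (W * X / 4) ^ 2 := by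
      have : (X / 4) ^ 2 + 1 = s * (W * X / 4) := by linear_combination h1 / 16
      rw [this]; ring
    rw [h2] at hz
    exact mul_right_cancel₀ (by positivity) hz
  subst hzs
  rcases Y_eq_of_X_eq h.left h'.left rfl with h3 | h3
  · subst h3
    exact ⟨_, h2R.symm⟩
  · refine ⟨-Point.some _ _ hR, ?_⟩
    rw [neg_nsmul, h2R, Point.neg_some]
    simp only [Point.some.injEq, true_and]
    exact h3

theorem exists_eq_two_nsmul_add {u : ℤ} (hu : u % 4 = 3) (hp : Prime (u ^ 2 + 64))
    (P : (NeumannSetzerE₁ u).Point) : ∃ R, P = 2 • R ∨ P = 2 • R + twoTorsionPoint u := by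
  rcases P with _ | ⟨x, y, h⟩
  · exact ⟨0, .inl (by rw [nsmul_zero]; rfl)⟩
  obtain ⟨a, ha⟩ : ∃ a, u = 4 * a - 1 := ⟨(u + 1) / 4, by omega⟩
  have he := (nonsingular_iff ha).mp h
  rcases eq_or_ne x 0 with rfl | hx
  · obtain rfl : y = 0 := by simpa using he
    exact ⟨0, .inr (by rw [nsmul_zero, zero_add]; rfl)⟩
  obtain ⟨s, rfl | rfl⟩ := exists_eq_sq_or_eq_neg_sq_of_equation he
  · obtain ⟨R, hR⟩ := exists_two_nsmul_eq_of_sq hu hp (by simpa using hx) h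
    exact ⟨R, .inl hR⟩
  · have hs : s ≠ 0 := by simpa using hx
    obtain ⟨w, h', hw⟩ := exists_some_add_twoTorsionPoint hu h hx
    have hx' : -1 / -s ^ 2 = s⁻¹ ^ 2 := by field_simp
    have key : ∀ (z : ℚ) (hz : (NeumannSetzerE₁ u).Nonsingular z w), z = s⁻¹ ^ 2 →
        ∃ R, Point.some z w hz = 2 • R := by
      rintro z hz rfl
      exact exists_two_nsmul_eq_of_sq hu hp (inv_ne_zero hs) hz
    obtain ⟨R, hR⟩ := key _ h' hx'
    refine ⟨R, .inr ?_⟩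
    rw [← hR, ← hw, add_assoc, ← two_nsmul, two_nsmul_twoTorsionPoint, add_zero]

theorem exists_eq_two_pow_nsmul_add {u : ℤ} (hu : u % 4 = 3) (hp : Prime (u ^ 2 + 64))
    (P : (NeumannSetzerE₁ u).Point) (n : ℕ) :
    ∃ R, P = 2 ^ n • R ∨ P = 2 ^ n • R + twoTorsionPoint u := by
  induction n with
  | zero => exact ⟨P, by simp⟩
  | succ n ih =>
    have hTT := two_nsmul_twoTorsionPoint u
    rw [two_nsmul] at hTT
    obtain ⟨R, hR⟩ := ih
    obtain ⟨S, hS⟩ := exists_eq_two_nsmul_add hu hp R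
    have hS' : 2 ^ n • R = 2 ^ (n + 1) • S ∨ 2 ^ n • R = 2 ^ (n + 1) • S + twoTorsionPoint u := by
      rcases hS with rfl | rfl
      · left; rw [smul_smul, pow_succ]
      · rw [nsmul_add, smul_smul, ← pow_succ]
        cases n with
        | zero => right; simp
        | succ n =>
          left
          rw [pow_succ' 2 n, mul_nsmul, two_nsmul, hTT, nsmul_zero, add_zero]
    refine ⟨S, ?_⟩
    rcases hS' with h | h <;> rcases hR with hR | hR <;> rw [hR, h]
    · exact .inl rfl
    · exact .inr rfl
    · exact .inr rfl
    · left; rw [add_assoc, hTT, add_zero]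

/-- The points which are the identity or whose `x`-coordinate has denominator divisible by `2 ^ n`:
for `n ≠ 0`, these are the points which are `2`-adically close to the identity. -/
def IsNearZero {u : ℤ} (n : ℕ) : (NeumannSetzerE₁ u).Point → Prop
  | .zero => True
  | .some x _ _ => 2 ^ n ∣ (x.den : ℤ)

theorem isNearZero_zero {u : ℤ} (n : ℕ) : IsNearZero n (0 : (NeumannSetzerE₁ u).Point) :=
  trivial

theorem IsNearZero.two_nsmul {u : ℤ} (hu : u % 4 = 3) {n : ℕ} (hn : n ≠ 0)
    {P : (NeumannSetzerE₁ u).Point} (hP : IsNearZero n P) : IsNearZero (n + 1) (2 • P) := by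
  rcases P with _ | ⟨x, y, h⟩
  · exact isNearZero_zero _
  by_cases hy : 2 * y + x = 0
  · rw [two_nsmul_some_eq_zero h hy]; exact isNearZero_zero _
  · obtain ⟨z, w, h', h2, hz⟩ := exists_two_nsmul_some hu h hy
    rw [sq_two_mul_add hu h] at hz
    rw [h2]
    exact two_pow_succ_dvd_den_of_duplication hz hn hP

theorem isNearZero_four_nsmul {u : ℤ} (hu : u % 4 = 3) (P : (NeumannSetzerE₁ u).Point) :
    IsNearZero 1 (2 • 2 • P) := by
  have even_case : ∀ {x y : ℚ} (h : (NeumannSetzerE₁ u).Nonsingular x y), Even x.num →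
      IsNearZero 1 (2 • Point.some x y h) := by
    intro x y h hx
    by_cases hy : 2 * y + x = 0
    · rw [two_nsmul_some_eq_zero h hy]; exact isNearZero_zero _
    · obtain ⟨z, w, h', h2, hz⟩ := exists_two_nsmul_some hu h hy
      rw [sq_two_mul_add hu h] at hz
      rw [h2]
      simpa [IsNearZero] using two_dvd_den_of_duplication hz hx
  have near_case : ∀ {Q : (NeumannSetzerE₁ u).Point}, IsNearZero 1 Q → IsNearZero 1 (2 • Q) := by
    intro Q hQ
    have := hQ.two_nsmul hu one_ne_zero
    rcases h2 : 2 • Q with _ | ⟨x, y, h⟩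
    · exact isNearZero_zero _
    · rw [h2] at this
      exact (pow_dvd_pow 2 one_le_two).trans this
  rcases P with _ | ⟨x, y, h⟩
  · exact isNearZero_zero _
  rcases Int.even_or_odd (x.den : ℤ) with hd | hd
  · exact near_case (near_case (by simpa [IsNearZero] using hd.two_dvd))
  rcases Int.even_or_odd x.num with hx | hx
  · exact near_case (even_case h hx)
  by_cases hy : 2 * y + x = 0
  · rw [two_nsmul_some_eq_zero h hy, nsmul_zero]; exact isNearZero_zero _
  · obtain ⟨z, w, h', h2, hz⟩ := exists_two_nsmul_some hu h hy
    rw [sq_two_mul_add hu h] at hz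
    rw [h2]
    exact even_case h' (even_num_of_duplication (Int.odd_iff.mpr (by omega)) hz hx hd)

theorem isNearZero_two_pow_nsmul {u : ℤ} (hu : u % 4 = 3) (P : (NeumannSetzerE₁ u).Point) (n : ℕ) :
    IsNearZero (n + 1) (2 ^ (n + 2) • P) := by
  induction n with
  | zero => simpa [smul_smul] using isNearZero_four_nsmul hu P
  | succ n ih =>
    have := ih.two_nsmul hu n.succ_ne_zero
    rwa [smul_smul, ← pow_succ'] at this

theorem exists_not_isNearZero {u : ℤ} {P : (NeumannSetzerE₁ u).Point} (hP : P ≠ 0) :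
    ∃ N, ∀ n ≥ N, ¬ IsNearZero n P := by
  rcases P with _ | ⟨x, y, h⟩
  · exact absurd rfl hP
  · refine ⟨x.den, fun n hn (hd : 2 ^ n ∣ (x.den : ℤ)) => ?_⟩
    have h1 : 2 ^ n ≤ x.den := Nat.le_of_dvd x.den_pos (by exact_mod_cast hd)
    exact absurd (hn.trans_lt Nat.lt_two_pow_self) h1.not_gt

theorem eq_zero_or_eq_twoTorsionPoint {u : ℤ} (hu : u % 4 = 3) (hp : Prime (u ^ 2 + 64))
    (P : (NeumannSetzerE₁ u).Point) : P = 0 ∨ P = twoTorsionPoint u := by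
  by_contra! hP
  obtain ⟨N, hN⟩ := exists_not_isNearZero hP.1
  obtain ⟨M, hM⟩ := exists_not_isNearZero (sub_ne_zero.mpr hP.2)
  obtain ⟨R, hR⟩ := exists_eq_two_pow_nsmul_add hu hp P (N + M + 2)
  have hnear := isNearZero_two_pow_nsmul hu R (N + M)
  rcases hR with hR | hR
  · exact hN (N + M + 1) (by omega) (hR ▸ hnear)
  · exact hM (N + M + 1) (by omega) (eq_sub_of_add_eq hR.symm ▸ hnear)

end NeumannSetzerE₁

theorem stmt_6 (u : ℤ) (hu : u % 4 = 3) (hp : Prime (u ^ 2 + 64)) :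
    Nonempty ((NeumannSetzerE₁ u).Point ≃+ ZMod 2) := by
  have hcard : Nat.card (NeumannSetzerE₁ u).Point = 2 := by
    rw [Nat.card_eq_two_iff]
    refine ⟨0, NeumannSetzerE₁.twoTorsionPoint u,
      (NeumannSetzerE₁.twoTorsionPoint_ne_zero u).symm, ?_⟩
    ext P
    simpa using NeumannSetzerE₁.eq_zero_or_eq_twoTorsionPoint hu hp P
  have := isAddCyclic_of_prime_card hcard
  exact ⟨((ZMod.ringEquivCongr hcard).symm.toAddEquiv.trans (zmodAddCyclicAddEquiv this)).symm⟩
end
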